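/- Let K be an infinite field (or any field with at least k+1 + n elements), f ∈ K[x_1,...,x_n] of total degree at most k, and G_k the Shpilka–Volkovich generator built from n distinct points a_1,...,a_n ∈ K. Then f is the zero polynomial if and only if the composed polynomial f(G_k^1,...,G_k^n) ∈ K[y_1,...,y_k,z_1,...,z_k] is the zero polynomial. -/

import Mathlib

open MvPolynomial in
/-- Setting the variables outside `I` to zero keeps the coefficients of monomials supported
in `I`. -/
theorem coeff_restrict_vars {K : Type*} [Field K] {n : ℕ} (I : Finset (Fin n))
    (m : Fin n →₀ ℕ) (hm : m.support ⊆ I) (f : MvPolynomial (Fin n) K) :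
    coeff m (aeval (fun i => if i ∈ I then (X i : MvPolynomial (Fin n) K) else 0) f)
      = coeff m f := by
  induction f using MvPolynomial.induction_on' with
  | add p q hp hq => rw [map_add, coeff_add, coeff_add, hp, hq]
  | monomial s c =>
    by_cases hs : s.support ⊆ I
    · congr 1
      rw [aeval_monomial, monomial_eq, algebraMap_eq]
      congr 1
      apply Finset.prod_congr rfl
      intro i hi
      simp [hs hi]
    · have hne : s ≠ m := fun h => hs (h ▸ hm)
      rw [coeff_monomial, if_neg hne]
      obtain ⟨i, hi, hiI⟩ := Finset.not_subset.mp hs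
      rw [aeval_monomial, Finsupp.prod, Finset.prod_eq_zero hi, mul_zero, coeff_zero]
      rw [if_neg hiI, zero_pow (Finsupp.mem_support_iff.mp hi)]

/-- A polynomial `f` of total degree at most `k` is zero iff its composition with the
Shpilka–Volkovich generator `G_k` (a polynomial in `2k` variables) is zero, provided
the field has at least `k + 1 + n` elements. -/
theorem sv_generator_preserves_nonzeroness
    {K : Type*} [Field K] {n k : ℕ}
    (hK : ∃ T : Finset K, k + 1 + n ≤ T.card)
    (a : Fin n → K) (ha : Function.Injective a)
    (f : MvPolynomial (Fin n) K) (hdeg : f.totalDegree ≤ k) :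
    f = 0 ↔
      MvPolynomial.aeval
        (fun i : Fin n =>
          ∑ j : Fin k,
            (MvPolynomial.C ((∏ l ∈ Finset.univ.erase i, (a i - a l))⁻¹) *
              ∏ l ∈ Finset.univ.erase i,
                (MvPolynomial.X (Sum.inl j) - MvPolynomial.C (a l))) *
            MvPolynomial.X (Sum.inr j)
          : Fin n → MvPolynomial (Fin k ⊕ Fin k) K) f = 0 := by
  
  classical
  constructor
  · rintro rfl
    exact map_zero _
  · intro h
    ext m
    rw [MvPolynomial.coeff_zero]
    by_contra hm
    have hcard : m.support.card ≤ k := by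
      refine le_trans ?_ (le_trans (MvPolynomial.le_totalDegree
        (MvPolynomial.mem_support_iff.mpr hm)) hdeg)
      rw [Finset.card_eq_sum_ones, Finsupp.sum]
      apply Finset.sum_le_sum
      intro i hi
      exact Nat.one_le_iff_ne_zero.mpr (Finsupp.mem_support_iff.mp hi)
    obtain ⟨e⟩ : Nonempty (m.support ↪ Fin k) := by
      apply Function.Embedding.nonempty_of_card_le
      rwa [Fintype.card_coe, Fintype.card_fin]
    let y : Fin k → MvPolynomial (Fin n) K :=
      Function.extend e (fun i => MvPolynomial.C (a i)) 0
    let z : Fin k → MvPolynomial (Fin n) K :=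
      Function.extend e (fun i => MvPolynomial.X i) 0
    have h2 := congrArg (MvPolynomial.aeval (R := K) (Sum.elim y z)) h
    rw [map_zero, ← AlgHom.comp_apply, MvPolynomial.comp_aeval] at h2
    apply hm
    rw [← coeff_restrict_vars m.support m subset_rfl f]
    refine Eq.trans ?_ (MvPolynomial.coeff_zero m)
    refine Eq.trans ?_ (congrArg (MvPolynomial.coeff m) h2)
    congr 3
    funext i
    simp only [map_sum, map_mul, map_prod, map_sub, MvPolynomial.aeval_X, Sum.elim_inl,
      Sum.elim_inr, MvPolynomial.aeval_C, MvPolynomial.algebraMap_eq]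
    rw [← Fintype.sum_of_injective e e.injective
      (fun i' : m.support => if (i' : Fin n) = i then MvPolynomial.X i else 0)]
    · by_cases hi : i ∈ m.support
      · rw [if_pos hi, Finset.sum_eq_single ⟨i, hi⟩]
        · simp
        · intro b _ hb
          exact if_neg fun hh => hb (Subtype.ext hh)
        · simp
      · rw [if_neg hi, Finset.sum_eq_zero]
        intro b _
        have hb : (b : Fin n) ≠ i := fun hh => hi (hh ▸ b.2)
        exact if_neg hb
    · intro j hj
      have : z j = 0 := Function.extend_apply' _ _ _ hj
      rw [this, mul_zero]
    · intro i'
      have hy : y (e i') = MvPolynomial.C (a i') := e.injective.extend_apply _ _ _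
      have hz : z (e i') = MvPolynomial.X (i' : Fin n) := e.injective.extend_apply _ _ _
      simp only [hy, hz]
      split_ifs with hi
      · rw [hi]
        simp only [← map_sub, ← map_prod, ← map_mul]
        rw [inv_mul_cancel₀, map_one, one_mul]
        rw [Finset.prod_ne_zero_iff]
        intro l hl
        exact sub_ne_zero.mpr fun hh => (Finset.mem_erase.mp hl).1 (ha hh).symm
      · have h0 : ∏ x ∈ Finset.univ.erase i,
            ((MvPolynomial.C (a i') : MvPolynomial (Fin n) K) - MvPolynomial.C (a x)) = 0 := by
          apply Finset.prod_eq_zero (i := (i' : Fin n))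
          · simp [hi]
          · simp
        rw [h0, mul_zero, zero_mul]
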